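/- Let φ : ℂⁿ → ℝ be a plurisubharmonic C^∞ function and let u = Σ_{j=1}^n u_j dz_j be a (1,0)-form with coefficients in A²(ℂⁿ, e^{-φ}) belonging to dom(∂) ∩ dom(∂*_φ). Then for all indices j, k one has ‖∂u_j/∂z_k‖²_φ = ‖(∂φ/∂z̄_k) u_j‖²_φ − ∫_{ℂⁿ} (∂²φ/∂z_k∂z̄_k) |u_j|² e^{-φ} dλ. -/

import Mathlib

open MeasureTheory Filter Complex Finset

noncomputable section

/-- Points of `ℂⁿ`. -/
abbrev Cn (n : ℕ) := Fin n → ℂ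

/-- The holomorphic partial derivative `∂f/∂z_j` of an entire function. -/
def pdz {n : ℕ} (j : Fin n) (f : Cn n → ℂ) : Cn n → ℂ :=
  fun z => fderiv ℂ f z (Pi.single j 1)

/-- The Wirtinger derivative `∂g/∂z_j` of a (not necessarily holomorphic)
function `g : ℂⁿ → ℂ`. -/
def wdz {n : ℕ} (j : Fin n) (g : Cn n → ℂ) : Cn n → ℂ :=
  fun z => (fderiv ℝ g z (Pi.single j 1) - Complex.I * fderiv ℝ g z (Pi.single j Complex.I)) / 2

/-- The Wirtinger derivative `∂g/∂z̄_j`. -/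
def wdzbar {n : ℕ} (j : Fin n) (g : Cn n → ℂ) : Cn n → ℂ :=
  fun z => (fderiv ℝ g z (Pi.single j 1) + Complex.I * fderiv ℝ g z (Pi.single j Complex.I)) / 2

/-- A real-valued function viewed as a complex-valued one. -/
def cplx {n : ℕ} (φ : Cn n → ℝ) : Cn n → ℂ := fun z => (φ z : ℂ)

/-- The entry `∂²φ/∂z_k ∂z̄_j` of the Levi matrix of `φ`. -/
def levi {n : ℕ} (φ : Cn n → ℝ) (j k : Fin n) : Cn n → ℂ := wdz k (wdzbar j (cplx φ))

/-- Plurisubharmonicity of a smooth function: the Levi matrix is positive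
semidefinite at every point. -/
def PSH {n : ℕ} (φ : Cn n → ℝ) : Prop :=
  ∀ z w : Cn n, 0 ≤ (∑ j, ∑ k, levi φ j k z * w j * (starRingEnd ℂ) (w k)).re

/-- The weight `e^{-φ}`. -/
def wWt {n : ℕ} (φ : Cn n → ℝ) (z : Cn n) : ℝ := Real.exp (-(φ z))

/-- Squared norm `‖f‖²_φ = ∫ |f|² e^{-φ} dλ`. -/
def wNormSq {n : ℕ} (φ : Cn n → ℝ) (f : Cn n → ℂ) : ℝ := ∫ z : Cn n, ‖f z‖ ^ 2 * wWt φ z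

/-- Inner product `(f,g)_φ = ∫ f ḡ e^{-φ} dλ`. -/
def wInner {n : ℕ} (φ : Cn n → ℝ) (f g : Cn n → ℂ) : ℂ :=
  ∫ z : Cn n, f z * (starRingEnd ℂ) (g z) * wWt φ z

/-- Membership in the weighted space of entire functions `A²(ℂⁿ, e^{-φ})`. -/
def MemA {n : ℕ} (φ : Cn n → ℝ) (f : Cn n → ℂ) : Prop :=
  Differentiable ℂ f ∧ Integrable (fun z : Cn n => ‖f z‖ ^ 2 * wWt φ z)

/-- Membership in `L²(ℂⁿ, e^{-φ})`. -/
def MemL2 {n : ℕ} (φ : Cn n → ℝ) (f : Cn n → ℂ) : Prop :=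
  AEStronglyMeasurable f volume ∧ Integrable (fun z : Cn n => ‖f z‖ ^ 2 * wWt φ z)

/-- `Pf` is the Bergman projection `P_φ V` of `V ∈ L²(ℂⁿ, e^{-φ})`: it belongs to
`A²(ℂⁿ, e^{-φ})` and `V - Pf` is orthogonal to `A²(ℂⁿ, e^{-φ})`. -/
def IsBergProj {n : ℕ} (φ : Cn n → ℝ) (V Pf : Cn n → ℂ) : Prop :=
  MemA φ Pf ∧ ∀ h : Cn n → ℂ, MemA φ h → wInner φ (fun z => V z - Pf z) h = 0

section CutoffIdentity

open Topology
open scoped ContDiff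

/-- The derivative of a real-valued function in the direction `v`. -/
def dirDeriv {E : Type*} [NormedAddCommGroup E] [NormedSpace ℝ E] (v : E) (h : E → ℝ) : E → ℝ :=
  fun z => fderiv ℝ h z v

variable {E : Type*} [NormedAddCommGroup E] [NormedSpace ℝ E]

theorem ContDiff.dirDeriv {h : E → ℝ} (hh : ContDiff ℝ ∞ h) (v : E) :
    ContDiff ℝ ∞ (dirDeriv v h) :=
  (hh.fderiv_right (m := ∞) (by simp)).clm_apply contDiff_const

theorem HasCompactSupport.dirDeriv {h : E → ℝ} (hh : HasCompactSupport h) (v : E) :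
    HasCompactSupport (dirDeriv v h) :=
  hh.fderiv_apply (𝕜 := ℝ) v

theorem hasLineDerivAt_dirDeriv {h : E → ℝ} (hh : ContDiff ℝ ∞ h) (v x : E) :
    HasLineDerivAt ℝ h (dirDeriv v h x) x v :=
  ((hh.differentiable (by simp)) x).hasFDerivAt.hasLineDerivAt v

theorem dirDeriv_comp_smul (v : E) (h : E → ℝ) (c : ℝ) :
    dirDeriv v (fun z => h (c • z)) = fun z => c * dirDeriv v h (c • z) := by
  ext z
  simp [dirDeriv, fderiv_comp_smul]

theorem dirDeriv_const_mul (v : E) {h : E → ℝ} (hh : ContDiff ℝ ∞ h) (c : ℝ) :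
    dirDeriv v (fun z => c * h z) = fun z => c * dirDeriv v h z := by
  ext z
  simp [dirDeriv, fderiv_const_mul (hh.differentiable (by simp) z)]

theorem dirDeriv_mul_exp_neg (v : E) {χ φ : E → ℝ} (hχ : ContDiff ℝ ∞ χ) (hφ : ContDiff ℝ ∞ φ) :
    dirDeriv v (fun z => χ z * Real.exp (-φ z)) =
      fun z => (dirDeriv v χ z - χ z * dirDeriv v φ z) * Real.exp (-φ z) := by
  ext z
  have h1 := ((hχ.differentiable (by simp)) z).hasFDerivAt
  have h2 := ((hφ.differentiable (by simp)) z).hasFDerivAt.neg.exp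
  have h3 := congrArg (fun l => l v) (h1.mul h2).fderiv
  simp only [dirDeriv]
  refine h3.trans ?_
  simp
  ring

theorem dirDeriv_dirDeriv_mul_exp_neg (v : E) {χ φ : E → ℝ} (hχ : ContDiff ℝ ∞ χ)
    (hφ : ContDiff ℝ ∞ φ) (z : E) :
    dirDeriv v (dirDeriv v (fun z => χ z * Real.exp (-φ z))) z =
      (dirDeriv v (dirDeriv v χ) z - 2 * dirDeriv v χ z * dirDeriv v φ z
        + χ z * (dirDeriv v φ z ^ 2 - dirDeriv v (dirDeriv v φ) z)) * Real.exp (-φ z) := by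
  have hsub : ContDiff ℝ ∞ (fun z => dirDeriv v χ z - χ z * dirDeriv v φ z) :=
    (hχ.dirDeriv v).sub (hχ.mul (hφ.dirDeriv v))
  rw [dirDeriv_mul_exp_neg v hχ hφ, dirDeriv_mul_exp_neg v hsub hφ]
  have h1 := (((hχ.dirDeriv v).differentiable (by simp)) z).hasFDerivAt
  have h2 := ((hχ.differentiable (by simp)) z).hasFDerivAt
  have h3 := (((hφ.dirDeriv v).differentiable (by simp)) z).hasFDerivAt
  have h4 : dirDeriv v (fun z => dirDeriv v χ z - χ z * dirDeriv v φ z) z =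
      dirDeriv v (dirDeriv v χ) z - (χ z * dirDeriv v (dirDeriv v φ) z
        + dirDeriv v φ z * dirDeriv v χ z) := by
    refine (congrArg (fun l => l v) (h1.sub (h2.mul h3)).fderiv).trans ?_
    simp [dirDeriv]
  simp only [h4]
  ring

/-- Smooth cutoffs `χ_m → 1` whose first two derivatives in two given directions are `O(1/m)`. -/
theorem exists_cutoff [FiniteDimensional ℝ E] (v w : E) : ∃ (M : ℝ) (χ : ℕ → E → ℝ), 0 ≤ M ∧ ∀ m,
    ContDiff ℝ ∞ (χ m) ∧ HasCompactSupport (χ m) ∧ (∀ x, 0 ≤ χ m x) ∧ (∀ x, χ m x ≤ 1) ∧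
    (∀ x ∈ Metric.closedBall (0 : E) (m + 1), χ m x = 1) ∧
    ∀ a ∈ ({v, w} : Set E), ∀ x, |dirDeriv a (χ m) x| ≤ M / (m + 1) ∧
      |dirDeriv a (dirDeriv a (χ m)) x| ≤ M / (m + 1) := by
  let b : ContDiffBump (0 : E) := ⟨1, 2, one_pos, one_lt_two⟩
  have hb : ContDiff ℝ ∞ b := b.contDiff
  have hbc : HasCompactSupport b := b.hasCompactSupport
  have bound : ∀ a : E, ∃ C, ∀ x, |dirDeriv a b x| ≤ C ∧ |dirDeriv a (dirDeriv a b) x| ≤ C := by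
    intro a
    obtain ⟨C₁, h₁⟩ := (hb.dirDeriv a).continuous.bounded_above_of_compact_support (hbc.dirDeriv a)
    obtain ⟨C₂, h₂⟩ := ((hb.dirDeriv a).dirDeriv a).continuous.bounded_above_of_compact_support
      ((hbc.dirDeriv a).dirDeriv a)
    exact ⟨max C₁ C₂, fun x => ⟨(h₁ x).trans (le_max_left _ _), (h₂ x).trans (le_max_right _ _)⟩⟩
  obtain ⟨Cv, hv⟩ := bound v
  obtain ⟨Cw, hw⟩ := bound w
  have hM : 0 ≤ max Cv Cw := ((abs_nonneg _).trans (hv 0).1).trans (le_max_left _ _)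
  refine ⟨max Cv Cw, fun m x => b (((m : ℝ) + 1)⁻¹ • x), hM, fun m => ?_⟩
  have hm : (0 : ℝ) < m + 1 := by positivity
  have hm1 : ((m : ℝ) + 1)⁻¹ ≤ 1 := inv_le_one_of_one_le₀ (by simp)
  refine ⟨hb.comp (contDiff_const_smul _), hbc.comp_smul (inv_ne_zero hm.ne'), fun x => b.nonneg,
    fun x => b.le_one, fun x hx => b.one_of_mem_closedBall ?_, fun a ha x => ?_⟩
  · rw [mem_closedBall_zero_iff] at hx ⊢
    rw [norm_smul, norm_inv, Real.norm_of_nonneg hm.le, inv_mul_le_iff₀ hm]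
    simpa [b] using hx
  · have ha' : ∀ x, |dirDeriv a b x| ≤ max Cv Cw ∧ |dirDeriv a (dirDeriv a b) x| ≤ max Cv Cw := by
      rcases ha with rfl | rfl
      · exact fun x => ⟨(hv x).1.trans (le_max_left _ _), (hv x).2.trans (le_max_left _ _)⟩
      · exact fun x => ⟨(hw x).1.trans (le_max_right _ _), (hw x).2.trans (le_max_right _ _)⟩
    have e1 := dirDeriv_comp_smul a b ((m : ℝ) + 1)⁻¹
    have e2 : dirDeriv a (dirDeriv a (fun x => b (((m : ℝ) + 1)⁻¹ • x))) x =
        ((m : ℝ) + 1)⁻¹ * (((m : ℝ) + 1)⁻¹ * dirDeriv a (dirDeriv a b) (((m : ℝ) + 1)⁻¹ • x)) := by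
      rw [e1, dirDeriv_const_mul a (h := fun x => dirDeriv a b (((m : ℝ) + 1)⁻¹ • x))
          ((hb.dirDeriv a).comp (contDiff_const_smul _)), dirDeriv_comp_smul]
    have hi : 0 ≤ ((m : ℝ) + 1)⁻¹ := by positivity
    rw [e2, e1, abs_mul, abs_mul, abs_mul, abs_of_nonneg hi, div_eq_inv_mul]
    refine ⟨mul_le_mul_of_nonneg_left (ha' _).1 hi, mul_le_mul_of_nonneg_left ?_ hi⟩
    exact (mul_le_of_le_one_left (abs_nonneg _) hm1).trans (ha' _).2

variable [FiniteDimensional ℝ E] [MeasurableSpace E] [BorelSpace E] {μ : Measure E}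
  [μ.IsAddHaarMeasure]

theorem integral_mul_lineDeriv_eq_neg {η g g' : E → ℝ} {v : E} (hη : ContDiff ℝ ∞ η)
    (hc : HasCompactSupport η) (hg : Continuous g) (hg' : Continuous g')
    (hd : ∀ x, HasLineDerivAt ℝ g (g' x) x v) :
    ∫ x, η x * g' x ∂μ = -∫ x, dirDeriv v η x * g x ∂μ := by
  have hη' := hη.dirDeriv v
  exact integral_bilinear_hasLineDerivAt_right_eq_neg_left_of_integrable
    (B := ContinuousLinearMap.mul ℝ ℝ)
    ((hη'.continuous.mul hg).integrable_of_hasCompactSupport (hc.dirDeriv v).mul_right)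
    ((hη.continuous.mul hg').integrable_of_hasCompactSupport hc.mul_right)
    ((hη.continuous.mul hg).integrable_of_hasCompactSupport hc.mul_right)
    (fun x _ => hasLineDerivAt_dirDeriv hη v x) (fun x _ => hd x)

theorem integral_mul_lineDeriv_lineDeriv {η g g' g'' : E → ℝ} {v : E} (hη : ContDiff ℝ ∞ η)
    (hc : HasCompactSupport η) (hg : Continuous g) (hg' : Continuous g') (hg'' : Continuous g'')
    (hd : ∀ x, HasLineDerivAt ℝ g (g' x) x v) (hd' : ∀ x, HasLineDerivAt ℝ g' (g'' x) x v) :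
    ∫ x, η x * g'' x ∂μ = ∫ x, dirDeriv v (dirDeriv v η) x * g x ∂μ := by
  rw [integral_mul_lineDeriv_eq_neg hη hc hg' hg'' hd',
    integral_mul_lineDeriv_eq_neg (hη.dirDeriv v) (hc.dirDeriv v) hg hg' hd, neg_neg]

theorem integral_cutoff_mul_lineDeriv_lineDeriv {χ φ g g' g'' : E → ℝ} {v : E}
    (hχ : ContDiff ℝ ∞ χ) (hc : HasCompactSupport χ) (hφ : ContDiff ℝ ∞ φ)
    (hg : Continuous g) (hg' : Continuous g') (hg'' : Continuous g'')
    (hd : ∀ x, HasLineDerivAt ℝ g (g' x) x v) (hd' : ∀ x, HasLineDerivAt ℝ g' (g'' x) x v) :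
    ∫ x, χ x * (g'' x + dirDeriv v (dirDeriv v φ) x * g x) * Real.exp (-φ x) ∂μ =
      ∫ x, (χ x * dirDeriv v φ x ^ 2 + (dirDeriv v (dirDeriv v χ) x
        - 2 * dirDeriv v χ x * dirDeriv v φ x)) * (g x * Real.exp (-φ x)) ∂μ := by
  have hexp : ContDiff ℝ ∞ (fun x => Real.exp (-φ x)) := hφ.neg.exp
  have hχ0 := hχ.continuous
  have hφ1 := (hφ.dirDeriv v).continuous
  have hφ2 := ((hφ.dirDeriv v).dirDeriv v).continuous
  have hη : ContDiff ℝ ∞ (fun x => χ x * Real.exp (-φ x)) := hχ.mul hexp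
  have hηc : HasCompactSupport (fun x => χ x * Real.exp (-φ x)) := hc.mul_right
  have key := integral_mul_lineDeriv_lineDeriv (μ := μ) hη hηc hg hg' hg'' hd hd'
  have i1 : Integrable (fun x => χ x * Real.exp (-φ x) * g'' x) μ :=
    (hη.continuous.mul hg'').integrable_of_hasCompactSupport hηc.mul_right
  have i2 : Integrable (fun x => χ x * Real.exp (-φ x) * (dirDeriv v (dirDeriv v φ) x * g x)) μ :=
    (hη.continuous.mul (hφ2.mul hg)).integrable_of_hasCompactSupport hηc.mul_right
  have i3 : Integrable
      (fun x => dirDeriv v (dirDeriv v fun x => χ x * Real.exp (-φ x)) x * g x) μ :=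
    (((hη.dirDeriv v).dirDeriv v).continuous.mul hg).integrable_of_hasCompactSupport
      ((hηc.dirDeriv v).dirDeriv v).mul_right
  calc
    _ = ∫ x, (χ x * Real.exp (-φ x) * g'' x
          + χ x * Real.exp (-φ x) * (dirDeriv v (dirDeriv v φ) x * g x)) ∂μ := by
      congr 1; ext x; ring
    _ = ∫ x, (dirDeriv v (dirDeriv v fun x => χ x * Real.exp (-φ x)) x * g x
          + χ x * Real.exp (-φ x) * (dirDeriv v (dirDeriv v φ) x * g x)) ∂μ := by
      rw [integral_add i1 i2, integral_add i3 i2, key]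
    _ = _ := by
      congr 1; ext x
      rw [dirDeriv_dirDeriv_mul_exp_neg v hχ hφ]
      ring

/-- If `g₁'` and `g₂'` are the second derivatives of `g ≥ 0` in the directions `v` and `w`, then
`∫ (Δg) e^{-φ} = ∫ |∇φ|² g e^{-φ} - ∫ (Δφ) g e^{-φ}`, with gradient and Laplacian taken in these two
directions, provided that `Δg` and `Δφ` are nonnegative and that `g e^{-φ}` and `|∇φ|² g e^{-φ}` are
integrable. -/
theorem integral_second_lineDeriv_eq_sub {φ g g₁ g₂ g₁' g₂' : E → ℝ} {v w : E}
    (hφ : ContDiff ℝ ∞ φ) (hg : Continuous g)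
    (hg₁ : Continuous g₁) (hg₁' : Continuous g₁') (hg₂ : Continuous g₂) (hg₂' : Continuous g₂')
    (hd₁ : ∀ x, HasLineDerivAt ℝ g (g₁ x) x v) (hd₁' : ∀ x, HasLineDerivAt ℝ g₁ (g₁' x) x v)
    (hd₂ : ∀ x, HasLineDerivAt ℝ g (g₂ x) x w) (hd₂' : ∀ x, HasLineDerivAt ℝ g₂ (g₂' x) x w)
    (h0 : ∀ x, 0 ≤ g x) (hP : ∀ x, 0 ≤ g₁' x + g₂' x)
    (hL : ∀ x, 0 ≤ dirDeriv v (dirDeriv v φ) x + dirDeriv w (dirDeriv w φ) x)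
    (hint : Integrable (fun x => g x * Real.exp (-φ x)) μ)
    (hintQ : Integrable (fun x =>
      (dirDeriv v φ x ^ 2 + dirDeriv w φ x ^ 2) * (g x * Real.exp (-φ x))) μ) :
    ∫ x, (g₁' x + g₂' x) * Real.exp (-φ x) ∂μ =
      ∫ x, (dirDeriv v φ x ^ 2 + dirDeriv w φ x ^ 2) * (g x * Real.exp (-φ x)) ∂μ
      - ∫ x, (dirDeriv v (dirDeriv v φ) x + dirDeriv w (dirDeriv w φ) x)
          * (g x * Real.exp (-φ x)) ∂μ := by
  obtain ⟨M, χ, hM, hχ⟩ := exists_cutoff v w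
  set W : E → ℝ := fun x => Real.exp (-φ x)
  set Q : E → ℝ := fun x => dirDeriv v φ x ^ 2 + dirDeriv w φ x ^ 2
  set L : E → ℝ := fun x => dirDeriv v (dirDeriv v φ) x + dirDeriv w (dirDeriv w φ) x
  set P : E → ℝ := fun x => g₁' x + g₂' x
  let err : ℕ → E → ℝ := fun m x =>
    (dirDeriv v (dirDeriv v (χ m)) x - 2 * dirDeriv v (χ m) x * dirDeriv v φ x)
    + (dirDeriv w (dirDeriv w (χ m)) x - 2 * dirDeriv w (χ m) x * dirDeriv w φ x)
  have hW0 : ∀ x, 0 ≤ W x := fun x => (Real.exp_pos _).le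
  have cW : Continuous W := (hφ.neg.exp).continuous
  have cv := (hφ.dirDeriv v).continuous
  have cw := (hφ.dirDeriv w).continuous
  have cvv := ((hφ.dirDeriv v).dirDeriv v).continuous
  have cww := ((hφ.dirDeriv w).dirDeriv w).continuous
  have cQ : Continuous Q := (cv.pow 2).add (cw.pow 2)
  have cL : Continuous L := cvv.add cww
  have cP : Continuous P := hg₁'.add hg₂'
  have identity : ∀ m, ∫ x, χ m x * ((P x + L x * g x) * W x) ∂μ =
      ∫ x, (χ m x * Q x + err m x) * (g x * W x) ∂μ := by
    intro m
    obtain ⟨hs, hc, -⟩ := hχ m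
    have i : ∀ (a : E) {h : E → ℝ}, Continuous h → Integrable (fun x =>
        χ m x * (h x + dirDeriv a (dirDeriv a φ) x * g x) * W x) μ := fun a h hh =>
      ((hs.continuous.mul (hh.add ((((hφ.dirDeriv a).dirDeriv a).continuous).mul hg))).mul
        cW).integrable_of_hasCompactSupport hc.mul_right.mul_right
    have j : ∀ a : E, Integrable (fun x => (χ m x * dirDeriv a φ x ^ 2
        + (dirDeriv a (dirDeriv a (χ m)) x - 2 * dirDeriv a (χ m) x * dirDeriv a φ x))
          * (g x * W x)) μ := fun a => by
      have ca := (hφ.dirDeriv a).continuous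
      have c1 := (hs.dirDeriv a).continuous
      have c2 := ((hs.dirDeriv a).dirDeriv a).continuous
      have c0 := hs.continuous
      refine Continuous.integrable_of_hasCompactSupport (by fun_prop) (HasCompactSupport.mul_right ?_)
      exact (hc.mul_right (f' := fun x => dirDeriv a φ x ^ 2)).add (((hc.dirDeriv a).dirDeriv a).sub
        ((hc.dirDeriv a).mul_left (f := fun _ => (2 : ℝ))).mul_right)
    have e1 := integral_cutoff_mul_lineDeriv_lineDeriv (μ := μ) hs hc hφ hg hg₁ hg₁' hd₁ hd₁'
    have e2 := integral_cutoff_mul_lineDeriv_lineDeriv (μ := μ) hs hc hφ hg hg₂ hg₂' hd₂ hd₂'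
    have e := congr (congrArg HAdd.hAdd e1) e2
    rw [← integral_add (i v hg₁') (i w hg₂'), ← integral_add (j v) (j w)] at e
    refine Eq.trans ?_ (e.trans ?_)
    · congr 1; ext x; simp only [P, L, W]; ring
    · congr 1; ext x; simp only [Q, err, W]; ring
  have err_le : ∀ m x, |err m x| ≤ M / (m + 1) * (4 + Q x) := by
    intro m x
    obtain ⟨-, -, -, -, -, hb⟩ := hχ m
    have single : ∀ a ∈ ({v, w} : Set E),
        |dirDeriv a (dirDeriv a (χ m)) x - 2 * dirDeriv a (χ m) x * dirDeriv a φ x|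
          ≤ M / (m + 1) * (2 + dirDeriv a φ x ^ 2) := by
      intro a ha
      obtain ⟨b1, b2⟩ := hb a ha x
      have hc : 0 ≤ M / ((m : ℝ) + 1) := by positivity
      have h2 : 2 * |dirDeriv a φ x| ≤ 1 + dirDeriv a φ x ^ 2 := by
        nlinarith [sq_nonneg (|dirDeriv a φ x| - 1), sq_abs (dirDeriv a φ x)]
      calc _ ≤ |dirDeriv a (dirDeriv a (χ m)) x| + |2 * dirDeriv a (χ m) x * dirDeriv a φ x| :=
            abs_sub _ _
        _ = |dirDeriv a (dirDeriv a (χ m)) x|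
            + |dirDeriv a (χ m) x| * (2 * |dirDeriv a φ x|) := by
          rw [abs_mul, abs_mul, abs_two]; ring
        _ ≤ M / (m + 1) + M / (m + 1) * (1 + dirDeriv a φ x ^ 2) := by gcongr
        _ = _ := by ring
    refine (abs_add_le _ _).trans ((add_le_add (single v (by simp)) (single w (by simp))).trans ?_)
    simp only [Q]
    exact le_of_eq (by ring)
  have lim_right : Tendsto (fun m : ℕ => ∫ x, (χ m x * Q x + err m x) * (g x * W x) ∂μ) atTop
      (𝓝 (∫ x, Q x * (g x * W x) ∂μ)) := by
    refine tendsto_integral_of_dominated_convergence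
      (fun x => (1 + M) * (Q x * (g x * W x)) + 4 * M * (g x * W x)) (fun m => ?_)
      ((hintQ.const_mul _).add (hint.const_mul _)) (fun m => ae_of_all _ fun x => ?_)
      (ae_of_all _ fun x => ?_)
    · obtain ⟨hs, -⟩ := hχ m
      have c0 := hs.continuous
      have c1 := (hs.dirDeriv v).continuous
      have c2 := ((hs.dirDeriv v).dirDeriv v).continuous
      have c3 := (hs.dirDeriv w).continuous
      have c4 := ((hs.dirDeriv w).dirDeriv w).continuous
      exact Continuous.aestronglyMeasurable (by fun_prop)
    · obtain ⟨-, -, hn, h1, -, -⟩ := hχ m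
      have hQ0 : 0 ≤ Q x := by positivity
      have hgW : 0 ≤ g x * W x := mul_nonneg (h0 x) (hW0 x)
      have hMm : M / ((m : ℝ) + 1) ≤ M := div_le_self hM (by simp)
      rw [Real.norm_eq_abs, abs_mul, abs_of_nonneg hgW]
      calc _ ≤ (|χ m x * Q x| + |err m x|) * (g x * W x) := by gcongr; exact abs_add_le _ _
        _ ≤ (1 * Q x + M * (4 + Q x)) * (g x * W x) := by
          rw [abs_mul, abs_of_nonneg (hn x), abs_of_nonneg hQ0]
          gcongr
          · exact h1 x
          · exact (err_le m x).trans (by gcongr)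
        _ = _ := by ring
    · have t1 : Tendsto (fun m => err m x) atTop (𝓝 0) := by
        refine squeeze_zero_norm (fun m => err_le m x) ?_
        have := (tendsto_one_div_add_atTop_nhds_zero_nat (𝕜 := ℝ)).const_mul (M * (4 + Q x))
        rw [mul_zero] at this
        exact this.congr fun m => by ring
      have t2 : Tendsto (fun m => χ m x) atTop (𝓝 1) := by
        refine tendsto_const_nhds.congr' ?_
        filter_upwards [eventually_ge_atTop ⌈‖x‖⌉₊] with m hm
        refine ((hχ m).2.2.2.2.1 x ?_).symm
        rw [mem_closedBall_zero_iff]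
        exact (Nat.ceil_le.1 hm).trans (by simp)
      simpa using ((t2.mul_const (Q x)).add t1).mul_const (g x * W x)
  have hF0 : ∀ x, 0 ≤ (P x + L x * g x) * W x := fun x =>
    mul_nonneg (add_nonneg (hP x) (mul_nonneg (hL x) (h0 x))) (hW0 x)
  have cF : Continuous fun x => (P x + L x * g x) * W x := (cP.add (cL.mul hg)).mul cW
  have intχF : ∀ m, Integrable (fun x => χ m x * ((P x + L x * g x) * W x)) μ := fun m =>
    ((hχ m).1.continuous.mul cF).integrable_of_hasCompactSupport (hχ m).2.1.mul_right
  have intF : Integrable (fun x => (P x + L x * g x) * W x) μ := by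
    obtain ⟨B, hB⟩ := lim_right.bddAbove_range
    have cover : AECover μ atTop (fun m : ℕ => Metric.closedBall (0 : E) ((m : ℝ) + 1)) :=
      aecover_closedBall (tendsto_atTop_add_const_right _ _ tendsto_natCast_atTop_atTop)
    refine cover.integrable_of_integral_bounded_of_nonneg_ae B
      (fun m => cF.continuousOn.integrableOn_compact (isCompact_closedBall _ _))
      (ae_of_all _ hF0) (Eventually.of_forall fun m => ?_)
    calc _ = ∫ x in Metric.closedBall (0 : E) ((m : ℝ) + 1),
          χ m x * ((P x + L x * g x) * W x) ∂μ :=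
          setIntegral_congr_fun Metric.isClosed_closedBall.measurableSet fun x hx => by
            simp [(hχ m).2.2.2.2.1 x hx]
      _ ≤ ∫ x, χ m x * ((P x + L x * g x) * W x) ∂μ :=
          setIntegral_le_integral (intχF m)
            (ae_of_all _ fun x => mul_nonneg ((hχ m).2.2.1 x) (hF0 x))
      _ ≤ B := by rw [identity m]; exact hB (Set.mem_range_self m)
  have lim_left : Tendsto (fun m : ℕ => ∫ x, χ m x * ((P x + L x * g x) * W x) ∂μ) atTop
      (𝓝 (∫ x, (P x + L x * g x) * W x ∂μ)) := by
    refine tendsto_integral_of_dominated_convergence _ (fun m => (intχF m).aestronglyMeasurable)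
      intF (fun m => ae_of_all _ fun x => ?_) (ae_of_all _ fun x => ?_)
    · rw [Real.norm_of_nonneg (mul_nonneg ((hχ m).2.2.1 x) (hF0 x))]
      exact mul_le_of_le_one_left (hF0 x) ((hχ m).2.2.2.1 x)
    · refine tendsto_const_nhds.congr' ?_
      filter_upwards [eventually_ge_atTop ⌈‖x‖⌉₊] with m hm
      rw [(hχ m).2.2.2.2.1 x, one_mul]
      rw [mem_closedBall_zero_iff]
      exact (Nat.ceil_le.1 hm).trans (by simp)
  have total : ∫ x, (P x + L x * g x) * W x ∂μ = ∫ x, Q x * (g x * W x) ∂μ :=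
    tendsto_nhds_unique lim_left (by simpa only [identity] using lim_right)
  have intL : Integrable (fun x => L x * (g x * W x)) μ := by
    refine intF.mono' (Continuous.aestronglyMeasurable (by fun_prop)) (ae_of_all _ fun x => ?_)
    rw [Real.norm_of_nonneg (mul_nonneg (hL x) (mul_nonneg (h0 x) (hW0 x)))]
    nlinarith [mul_nonneg (hP x) (hW0 x)]
  rw [← total, ← integral_sub intF intL]
  congr 1; ext x; ring

end CutoffIdentity

section ComplexLines

variable {E : Type*} [NormedAddCommGroup E] [NormedSpace ℂ E]

/-- The complex derivative of `f` at `z` along the line `ζ ↦ z + ζ e`. -/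
def cLineDeriv (e : E) (f : E → ℂ) : E → ℂ := fun z => lineDeriv ℂ f z e

/-- `f` is continuous and entire along every complex line in the direction `e`. -/
def EntireAlong (e : E) (f : E → ℂ) : Prop :=
  Continuous f ∧ ∀ z, Differentiable ℂ fun ζ : ℂ => f (z + ζ • e)

theorem Differentiable.entireAlong {f : E → ℂ} (hf : Differentiable ℂ f) (e : E) :
    EntireAlong e f :=
  ⟨hf.continuous, fun z => hf.comp (by fun_prop)⟩

theorem cLineDeriv_add_smul (e : E) (f : E → ℂ) (z : E) (ζ : ℂ) :
    cLineDeriv e f (z + ζ • e) = deriv (fun ξ : ℂ => f (z + ξ • e)) ζ := by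
  have h := deriv_comp_const_add (fun ξ : ℂ => f (z + ξ • e)) ζ 0
  rw [add_zero] at h
  rw [← h]
  simp only [cLineDeriv, lineDeriv, add_smul, add_assoc]

theorem EntireAlong.cLineDeriv {e : E} {f : E → ℂ} (hf : EntireAlong e f) :
    EntireAlong e (cLineDeriv e f) := by
  constructor
  · have formula : _root_.cLineDeriv e f = fun z => (2 * Real.pi * I)⁻¹ *
        ∫ θ : ℝ in 0..2 * Real.pi, deriv (circleMap 0 1) θ •
          ((1 / (circleMap 0 1 θ - 0) ^ 2) • f (z + circleMap 0 1 θ • e)) := by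
      ext z
      have h := (hf.2 z).diffContOnCl.deriv_eq_smul_circleIntegral (c := 0) (R := 1) one_pos
      rw [circleIntegral, smul_eq_mul] at h
      rw [h, inv_mul_cancel_left₀ (by simp [Real.pi_ne_zero])]
      rfl
    rw [formula]
    refine continuous_const.mul
      (intervalIntegral.continuous_parametric_intervalIntegral_of_continuous' ?_ _ _)
    have hc := hf.1
    have hne : ∀ p : E × ℝ, (circleMap 0 1 p.2 - 0) ^ 2 ≠ 0 := fun p => by simp
    simp only [Function.uncurry_def, deriv_circleMap]
    fun_prop (disch := exact hne _)
  · intro z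
    simp only [cLineDeriv_add_smul]
    exact (hf.2 z).contDiff.differentiable_deriv_two

theorem EntireAlong.hasLineDerivAt {e : E} {f : E → ℂ} (hf : EntireAlong e f) (w : ℂ) (z : E) :
    HasLineDerivAt ℝ f (w * _root_.cLineDeriv e f z) z (w • e) := by
  have h1 : HasDerivAt (fun ζ : ℂ => f (z + ζ • e)) (_root_.cLineDeriv e f z) ((0 : ℝ) * w) := by
    simpa [_root_.cLineDeriv, lineDeriv] using ((hf.2 z) 0).hasDerivAt
  have h2 : HasDerivAt (fun t : ℝ => (t : ℂ) * w) w 0 := by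
    simpa using (hasDerivAt_id (0 : ℝ)).ofReal_comp.mul_const w
  have h3 := HasDerivAt.comp (0 : ℝ) h1 h2
  rw [HasLineDerivAt, mul_comm]
  refine h3.congr_of_eventuallyEq (Eventually.of_forall fun t => ?_)
  simp [mul_smul]

/-- The derivative of `Re (c p q̄)` along a real line in the complex direction `w e`. -/
theorem EntireAlong.hasLineDerivAt_re_mul_conj {e : E} {p q : E → ℂ} (hp : EntireAlong e p)
    (hq : EntireAlong e q) (c w : ℂ) (z : E) :
    HasLineDerivAt ℝ (fun z => (c * (p z * (starRingEnd ℂ) (q z))).re)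
      (c * (w * _root_.cLineDeriv e p z * (starRingEnd ℂ) (q z)
        + p z * (starRingEnd ℂ) (w * _root_.cLineDeriv e q z))).re z (w • e) := by
  have h1 := hp.hasLineDerivAt w z
  have h2 := hq.hasLineDerivAt w z
  rw [HasLineDerivAt] at h1 h2 ⊢
  have h3 := Complex.reCLM.hasFDerivAt.comp_hasDerivAt (0 : ℝ) ((h1.mul h2.star).const_mul c)
  exact h3.congr_deriv (by simp)

end ComplexLines

section WeightedIdentity

open scoped ContDiff

variable {n : ℕ}

theorem single_eq_smul_single_one (k : Fin n) (w : ℂ) :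
    (Pi.single k w : Cn n) = w • (Pi.single k 1 : Cn n) := by
  rw [← Pi.single_smul, smul_eq_mul, mul_one]

theorem pdz_eq_cLineDeriv {f : Cn n → ℂ} (hf : Differentiable ℂ f) (k : Fin n) :
    pdz k f = cLineDeriv (Pi.single k 1) f :=
  funext fun z => ((hf z).lineDeriv_eq_fderiv).symm

theorem fderiv_ofReal_comp {h : Cn n → ℝ} (hh : ContDiff ℝ ∞ h) (z v : Cn n) :
    fderiv ℝ (fun z => (h z : ℂ)) z v = (dirDeriv v h z : ℂ) := by
  have h1 := ((hh.differentiable (by simp)) z).hasFDerivAt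
  have h2 := (Complex.ofRealCLM.hasFDerivAt.comp z h1).fderiv
  exact congrArg (fun l => l v) h2

theorem wdzbar_cplx {φ : Cn n → ℝ} (hφ : ContDiff ℝ ∞ φ) (k : Fin n) :
    wdzbar k (cplx φ) = fun z => ((dirDeriv (Pi.single k 1) φ z : ℂ)
      + I * (dirDeriv (Pi.single k I) φ z : ℂ)) / 2 := by
  ext z
  simp only [wdzbar, show cplx φ = fun z => (φ z : ℂ) from rfl, fderiv_ofReal_comp hφ]

theorem norm_wdzbar_cplx_sq {φ : Cn n → ℝ} (hφ : ContDiff ℝ ∞ φ) (k : Fin n) (z : Cn n) :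
    ‖wdzbar k (cplx φ) z‖ ^ 2 =
      (dirDeriv (Pi.single k 1) φ z ^ 2 + dirDeriv (Pi.single k I) φ z ^ 2) / 4 := by
  rw [wdzbar_cplx hφ, ← Complex.normSq_eq_norm_sq, Complex.normSq_div, Complex.normSq_apply]
  simp
  ring

theorem levi_self_re {φ : Cn n → ℝ} (hφ : ContDiff ℝ ∞ φ) (k : Fin n) (z : Cn n) :
    (levi φ k k z).re = (dirDeriv (Pi.single k 1) (dirDeriv (Pi.single k 1) φ) z
      + dirDeriv (Pi.single k I) (dirDeriv (Pi.single k I) φ) z) / 4 := by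
  set a : Cn n := Pi.single k 1 with ha
  set b : Cn n := Pi.single k I with hb
  have deriv_eq : ∀ v : Cn n, fderiv ℝ (wdzbar k (cplx φ)) z v =
      ((dirDeriv v (dirDeriv a φ) z : ℂ) + I * (dirDeriv v (dirDeriv b φ) z : ℂ)) / 2 := by
    intro v
    have hA := (((hφ.dirDeriv a).differentiable (by simp)) z).hasFDerivAt
    have hB := (((hφ.dirDeriv b).differentiable (by simp)) z).hasFDerivAt
    have h := (((Complex.ofRealCLM.hasFDerivAt.comp z hA).add
      ((Complex.ofRealCLM.hasFDerivAt.comp z hB).const_mul I)).mul_const (2⁻¹ : ℂ)).fderiv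
    have heq : wdzbar k (cplx φ) = fun z => ((dirDeriv a φ z : ℂ)
        + I * (dirDeriv b φ z : ℂ)) * 2⁻¹ := by
      rw [wdzbar_cplx hφ]; simp only [div_eq_mul_inv, a, b]
    rw [heq]
    refine (congrArg (fun l => l v) h).trans ?_
    simp [dirDeriv]
    ring
  simp only [levi, wdz]
  rw [← ha, ← hb, deriv_eq, deriv_eq]
  simp
  ring

theorem PSH.levi_self_re_nonneg {φ : Cn n → ℝ} (h : PSH φ) (k : Fin n) (z : Cn n) :
    0 ≤ (levi φ k k z).re := by
  simpa [Pi.single_apply] using h z (Pi.single k 1)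

/-- The identity for a single coefficient. -/
theorem wNormSq_pdz_eq_sub {φ : Cn n → ℝ} (hφ : ContDiff ℝ ∞ φ) (hps : PSH φ) {f : Cn n → ℂ}
    (hf : MemA φ f) (k : Fin n) (hL2 : MemL2 φ fun z => wdzbar k (cplx φ) z * f z) :
    wNormSq φ (pdz k f) = wNormSq φ (fun z => wdzbar k (cplx φ) z * f z)
      - ∫ z : Cn n, (levi φ k k z).re * ‖f z‖ ^ 2 * wWt φ z := by
  set e : Cn n := Pi.single k 1
  have ef : EntireAlong e f := hf.1.entireAlong e
  have ef₁ := ef.cLineDeriv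
  have ef₂ := ef₁.cLineDeriv
  set f₁ := cLineDeriv e f
  set f₂ := cLineDeriv e f₁
  have c0 := ef.1
  have c1 := ef₁.1
  have c2 := ef₂.1
  let g : Cn n → ℝ := fun z => ‖f z‖ ^ 2
  let g₁ : ℂ → Cn n → ℝ := fun w z => (2 * w * (f₁ z * (starRingEnd ℂ) (f z))).re
  let g₂ : ℂ → Cn n → ℝ := fun w z => (2 * w * (w * f₂ z * (starRingEnd ℂ) (f z)
    + f₁ z * (starRingEnd ℂ) (w * f₁ z))).re
  have cg : Continuous g := by fun_prop
  have cg₁ : ∀ w, Continuous (g₁ w) := fun w =>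
    Complex.continuous_re.comp (by fun_prop)
  have cg₂ : ∀ w, Continuous (g₂ w) := fun w =>
    Complex.continuous_re.comp (by fun_prop)
  have d₁ : ∀ w z, HasLineDerivAt ℝ g (g₁ w z) z (Pi.single k w) := by
    intro w z
    rw [single_eq_smul_single_one]
    have h := ef.hasLineDerivAt_re_mul_conj ef 1 w z
    have hg : g = fun z => (1 * (f z * (starRingEnd ℂ) (f z))).re := by
      ext z
      simp [g, ← Complex.normSq_eq_norm_sq, Complex.normSq_apply]
    have hg₁ : g₁ w z = (1 * (w * f₁ z * (starRingEnd ℂ) (f z)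
        + f z * (starRingEnd ℂ) (w * f₁ z))).re := by
      simp [g₁]
      ring
    rw [hg, hg₁]
    exact h
  have d₂ : ∀ w z, HasLineDerivAt ℝ (g₁ w) (g₂ w z) z (Pi.single k w) := by
    intro w z
    rw [single_eq_smul_single_one]
    exact ef₁.hasLineDerivAt_re_mul_conj ef (2 * w) w z
  have sum_eq : ∀ z, g₂ 1 z + g₂ I z = 4 * ‖f₁ z‖ ^ 2 := by
    intro z
    simp [g₂, ← Complex.normSq_eq_norm_sq, Complex.normSq_apply]
    ring
  have hQ : ∀ z, ‖wdzbar k (cplx φ) z * f z‖ ^ 2 * wWt φ z =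
      (1 / 4) * ((dirDeriv (Pi.single k 1) φ z ^ 2 + dirDeriv (Pi.single k I) φ z ^ 2)
        * (g z * Real.exp (-φ z))) := by
    intro z
    rw [norm_mul, mul_pow, norm_wdzbar_cplx_sq hφ]
    simp only [wWt, g]
    ring
  have key := integral_second_lineDeriv_eq_sub (μ := (volume : Measure (Cn n))) hφ cg (cg₁ 1)
    (cg₂ 1) (cg₁ I) (cg₂ I) (d₁ 1) (d₂ 1) (d₁ I) (d₂ I) (fun z => by positivity)
    (fun z => by rw [sum_eq]; positivity)
    (fun z => by linarith [levi_self_re hφ k z, hps.levi_self_re_nonneg k z])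
    hf.2 (by
      refine (hL2.2.const_mul 4).congr (ae_of_all _ fun z => ?_)
      simp only [hQ]
      ring)
  have hl : ∀ z, (levi φ k k z).re * ‖f z‖ ^ 2 * wWt φ z = (1 / 4) *
      ((dirDeriv (Pi.single k 1) (dirDeriv (Pi.single k 1) φ) z
        + dirDeriv (Pi.single k I) (dirDeriv (Pi.single k I) φ) z)
        * (g z * Real.exp (-φ z))) := by
    intro z
    rw [levi_self_re hφ]
    simp only [wWt, g]
    ring
  have hp : ∀ z, ‖pdz k f z‖ ^ 2 * wWt φ z = (1 / 4) * ((g₂ 1 z + g₂ I z) * Real.exp (-φ z)) := by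
    intro z
    rw [pdz_eq_cLineDeriv hf.1, sum_eq]
    simp only [wWt, f₁, e]
    ring
  simp only [wNormSq, hQ, hl, hp, integral_const_mul]
  rw [key]
  ring

end WeightedIdentity

/-- For `u ∈ dom ∂ ∩ dom ∂*_φ` with holomorphic coefficients `u_j`, one has
`‖∂u_j/∂z_k‖²_φ = ‖φ_{k̄} u_j‖²_φ − ∫ φ_{k k̄} |u_j|² e^{-φ} dλ`. -/
theorem stmt8 {n : ℕ} (φ : Cn n → ℝ) (hφ : ContDiff ℝ (⊤ : ℕ∞) φ) (hps : PSH φ)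
    (u : Fin n → Cn n → ℂ) (hu : ∀ j, MemA φ (u j))
    (hdom : ∀ j k, MemA φ (fun z => pdz k (u j) z - pdz j (u k) z))
    (hL2 : ∀ j k, MemL2 φ (fun z => wdzbar k (cplx φ) z * u j z)) :
    ∀ j k, wNormSq φ (pdz k (u j))
      = wNormSq φ (fun z => wdzbar k (cplx φ) z * u j z)
        - ∫ z : Cn n, (levi φ k k z).re * ‖u j z‖ ^ 2 * wWt φ z := by
  exact fun j k => wNormSq_pdz_eq_sub hφ hps (hu j) k (hL2 j k)
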